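/- arXiv:1610.07520 — 5 statements merged into one kernel-verified Lean document; each statement's English description precedes it below -/
import Mathlib

section
/- Let K and M be positive natural numbers. The set D = { T : (Fin K → Fin M) → ℂ | ∃ v : Fin K → (Fin M → ℂ), ∀ i, T i = ∏ k, v k (i k) } of decomposable (rank-at-most-one) order-K tensors is a closed subset of the finite-dimensional complex space EuclideanSpace ℂ (Fin K → Fin M). -/
/-- The polynomial equations satisfied by a decomposable tensor. -/
theorem decomposable_pow_mul_eq_prod_update {ι α R : Type*} [Fintype ι] [DecidableEq ι]
    [CommSemiring R] (v : ι → α → R) (a i : ι → α) :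
    (∏ k, v k (a k)) ^ (Fintype.card ι - 1) * ∏ k, v k (i k) =
      ∏ k, ∏ j, v j (Function.update a k (i k) j) := by
  rw [Finset.prod_comm, ← Finset.prod_pow, ← Finset.prod_mul_distrib]
  refine Finset.prod_congr rfl fun j _ => ?_
  rw [← Finset.prod_erase_mul _ _ (Finset.mem_univ j), Function.update_self,
    Finset.prod_congr rfl (g := fun _ => v j (a j)) fun k hk => by
      rw [Function.update_of_ne (Finset.ne_of_mem_erase hk).symm]]
  simp [Finset.card_erase_of_mem]

/-- A tensor over a field is decomposable if and only if it satisfies the equations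
`T a ^ (n - 1) * T i = ∏ k, T (update a k (i k))`, where `n` is its order. -/
theorem exists_decomposition_iff {ι α F : Type*} [Fintype ι] [DecidableEq ι] [Nonempty ι]
    [Field F] (T : (ι → α) → F) :
    (∃ v : ι → α → F, ∀ i, T i = ∏ k, v k (i k)) ↔
      ∀ a i, T a ^ (Fintype.card ι - 1) * T i = ∏ k, T (Function.update a k (i k)) := by
  constructor
  · rintro ⟨v, hv⟩ a i
    simp only [hv, decomposable_pow_mul_eq_prod_update]
  · intro h
    obtain ⟨k₀⟩ := ‹Nonempty ι›
    by_cases hT : ∃ a, T a ≠ 0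
    · obtain ⟨a, ha⟩ := hT
      refine ⟨fun k m => (if k = k₀ then (T a ^ (Fintype.card ι - 1))⁻¹ else 1) *
        T (Function.update a k m), fun i => ?_⟩
      rw [Finset.prod_mul_distrib, ← h a i, Finset.prod_ite_eq' Finset.univ k₀ fun _ => _,
        if_pos (Finset.mem_univ k₀), inv_mul_cancel_left₀ (pow_ne_zero _ ha)]
    · push Not at hT
      exact ⟨0, fun i => by simp [hT, Finset.prod_eq_zero (Finset.mem_univ k₀)]⟩

/-- The set of decomposable (rank-at-most-one) order-`K` tensors is closed in
`EuclideanSpace ℂ (Fin K → Fin M)`. -/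
theorem decomposable_isClosed (K M : ℕ) (hK : 0 < K) (hM : 0 < M) :
    IsClosed {T : EuclideanSpace ℂ (Fin K → Fin M) |
      ∃ v : Fin K → (Fin M → ℂ), ∀ i, T i = ∏ k, v k (i k)} := by
  have : Nonempty (Fin K) := ⟨⟨0, hK⟩⟩
  simp only [exists_decomposition_iff, Set.ofPred_forall]
  exact isClosed_iInter fun a => isClosed_iInter fun i =>
    isClosed_eq (by fun_prop) (by fun_prop)
end

section
/- With J, g as defined in the context (R Hermitian, R_d real), the mean-square-error cost J : (Fin K → (Fin M → ℂ)) → ℝ is differentiable over ℝ at every point w, and its ℝ-Fréchet derivative at w applied to a direction h : Fin K → (Fin M → ℂ) equals 2 · ∑ s, Re (∑ m, g s w m * h s m). In particular the block of the (Wirtinger) gradient of J with respect to w_s is the vector g s w = [−R_{u^K d} + W* R_{u^K}] W^{(s)}, where W^{(s)} is W with the s-th factor replaced by the identity. -/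
open Finset

/-- The decomposable tensor `𝒲` built from the factors `w`. -/
noncomputable def volterraW (K M : ℕ) (w : Fin K → Fin M → ℂ) : (Fin K → Fin M) → ℂ :=
  fun i => ∏ k, w k (i k)

/-- The mean-square-error cost
`J w = R_d − 2 Re (∑ j, r j (W w) j) + Re (∑ i j, conj ((W w) i) R i j (W w) j)`. -/
noncomputable def volterraJ (K M : ℕ) (R : Matrix (Fin K → Fin M) (Fin K → Fin M) ℂ)
    (r : (Fin K → Fin M) → ℂ) (Rd : ℝ) (w : Fin K → Fin M → ℂ) : ℝ :=
  Rd - 2 * (∑ j, r j * volterraW K M w j).re +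
    (∑ i, ∑ j, (starRingEnd ℂ) (volterraW K M w i) * R i j * volterraW K M w j).re

/-- The gradient block `g s w = [−R_{u^K d} + W* R_{u^K}] W^{(s)}`. -/
noncomputable def volterraGrad (K M : ℕ) (R : Matrix (Fin K → Fin M) (Fin K → Fin M) ℂ)
    (r : (Fin K → Fin M) → ℂ) (s : Fin K) (w : Fin K → Fin M → ℂ) (m : Fin M) : ℂ :=
  ∑ j ∈ univ.filter (fun j : Fin K → Fin M => j s = m),
    (-(r j) + ∑ i, (starRingEnd ℂ) (volterraW K M w i) * R i j) *
      ∏ ℓ ∈ univ.erase s, w ℓ (j ℓ)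

/-- The real differential of the `j`-th entry of the decomposable tensor `volterraW`. -/
noncomputable def volterraWDeriv (K M : ℕ) (w : Fin K → Fin M → ℂ) (j : Fin K → Fin M) :
    (Fin K → Fin M → ℂ) →L[ℝ] ℂ :=
  ∑ s, (∏ ℓ ∈ univ.erase s, w ℓ (j ℓ)) •
    (ContinuousLinearMap.proj (R := ℝ) (φ := fun _ : Fin M => ℂ) (j s)).comp
      (ContinuousLinearMap.proj (R := ℝ) (φ := fun _ : Fin K => Fin M → ℂ) s)

theorem volterraWDeriv_apply (K M : ℕ) (w h : Fin K → Fin M → ℂ) (j : Fin K → Fin M) :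
    volterraWDeriv K M w j h = ∑ s, (∏ ℓ ∈ univ.erase s, w ℓ (j ℓ)) * h s (j s) := by
  simp [volterraWDeriv]

theorem hasFDerivAt_volterraW (K M : ℕ) (w : Fin K → Fin M → ℂ) (j : Fin K → Fin M) :
    HasFDerivAt (fun w => volterraW K M w j) (volterraWDeriv K M w j) w := by
  unfold volterraW volterraWDeriv
  refine HasFDerivAt.finsetProd fun s _ => ?_
  exact ((ContinuousLinearMap.proj (R := ℝ) (φ := fun _ : Fin M => ℂ) (j s)).comp
    (ContinuousLinearMap.proj (R := ℝ) (φ := fun _ : Fin K => Fin M → ℂ) s)).hasFDerivAt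

theorem exists_hasFDerivAt_volterraJ (K M : ℕ)
    (R : Matrix (Fin K → Fin M) (Fin K → Fin M) ℂ) (r : (Fin K → Fin M) → ℂ) (Rd : ℝ)
    (w : Fin K → Fin M → ℂ) :
    ∃ L : (Fin K → Fin M → ℂ) →L[ℝ] ℝ, HasFDerivAt (volterraJ K M R r Rd) L w ∧
      ∀ h, L h = -(2 * (∑ j, r j * volterraWDeriv K M w j h).re) +
        (∑ i, ∑ j, ((starRingEnd ℂ) (volterraW K M w i) * R i j * volterraWDeriv K M w j h +
          (starRingEnd ℂ) (volterraWDeriv K M w i h) * R i j * volterraW K M w j)).re := by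
  have hW := hasFDerivAt_volterraW K M w
  have hconj (i : Fin K → Fin M) :=
    (Complex.conjCLE : ℂ →L[ℝ] ℂ).hasFDerivAt.comp w (hW i)
  have hlin := Complex.reCLM.hasFDerivAt.comp w
    (HasFDerivAt.fun_sum (u := univ) fun j _ => (hW j).const_mul (r j))
  have hquad := Complex.reCLM.hasFDerivAt.comp w
    (HasFDerivAt.fun_sum (u := univ) fun i _ => HasFDerivAt.fun_sum (u := univ) fun j _ =>
      ((hconj i).mul_const (R i j)).mul (hW j))
  refine ⟨_, ((hlin.const_mul 2).const_sub Rd).add hquad, fun h => ?_⟩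
  simp
  exact sum_congr rfl fun i _ => sum_congr rfl fun j _ => by ring

/-- For Hermitian `R`, the two halves of the polarized quadratic form have equal real part. -/
theorem re_sum_conj_mul_swap {ι : Type*} [Fintype ι] (R : Matrix ι ι ℂ)
    (hR : ∀ i j, R i j = (starRingEnd ℂ) (R j i)) (x y : ι → ℂ) :
    (∑ i, ∑ j, (starRingEnd ℂ) (x i) * R i j * y j).re =
      (∑ i, ∑ j, (starRingEnd ℂ) (y i) * R i j * x j).re := by
  rw [← Complex.conj_re, sum_comm]
  congr 1
  simp only [map_sum, map_mul, Complex.conj_conj, ← hR]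
  exact sum_congr rfl fun i _ => sum_congr rfl fun j _ => by ring

theorem sum_volterraGrad_mul (K M : ℕ) (R : Matrix (Fin K → Fin M) (Fin K → Fin M) ℂ)
    (r : (Fin K → Fin M) → ℂ) (w h : Fin K → Fin M → ℂ) :
    ∑ s, ∑ m, volterraGrad K M R r s w m * h s m =
      ∑ j, (-(r j) + ∑ i, (starRingEnd ℂ) (volterraW K M w i) * R i j) *
        volterraWDeriv K M w j h := by
  simp only [volterraWDeriv_apply, mul_sum]
  rw [sum_comm (s := (univ : Finset (Fin K → Fin M)))]
  refine sum_congr rfl fun s _ => ?_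
  rw [← sum_fiberwise univ (fun j : Fin K → Fin M => j s)]
  refine sum_congr rfl fun m _ => ?_
  rw [volterraGrad, sum_mul]
  refine sum_congr rfl fun j hj => ?_
  rw [(mem_filter.mp hj).2, mul_assoc]

/-- The MSE cost `J` is ℝ-differentiable at every `w`, with real Fréchet derivative
`h ↦ 2 ∑ s, Re (∑ m, g s w m * h s m)`; i.e. the Wirtinger-gradient block with respect
to `w_s` is `g s w = [−R_{u^K d} + W* R_{u^K}] W^{(s)}`. -/
theorem volterraJ_hasGradient (K M : ℕ) (hK : 0 < K) (hM : 0 < M)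
    (R : Matrix (Fin K → Fin M) (Fin K → Fin M) ℂ)
    (hR : ∀ i j, R i j = (starRingEnd ℂ) (R j i))
    (r : (Fin K → Fin M) → ℂ) (Rd : ℝ) (w : Fin K → Fin M → ℂ) :
    DifferentiableAt ℝ (volterraJ K M R r Rd) w ∧
      ∀ h : Fin K → Fin M → ℂ,
        fderiv ℝ (volterraJ K M R r Rd) w h =
          2 * ∑ s, (∑ m, volterraGrad K M R r s w m * h s m).re := by
  obtain ⟨L, hL, hLh⟩ := exists_hasFDerivAt_volterraJ K M R r Rd w
  refine ⟨hL.differentiableAt, fun h => ?_⟩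
  have hquad : ∑ j, (∑ i, (starRingEnd ℂ) (volterraW K M w i) * R i j) *
      volterraWDeriv K M w j h =
      ∑ i, ∑ j, (starRingEnd ℂ) (volterraW K M w i) * R i j * volterraWDeriv K M w j h := by
    simp only [sum_mul]
    exact sum_comm
  rw [hL.fderiv, hLh, ← Complex.re_sum, sum_volterraGrad_mul]
  simp only [add_mul, sum_add_distrib, hquad, neg_mul, sum_neg_distrib, Complex.add_re,
    Complex.neg_re]
  rw [re_sum_conj_mul_swap R hR (fun i => volterraWDeriv K M w i h)]
  ring
end

section
/- With J, g as defined in the context (R Hermitian, R_d real): if w : Fin K → (Fin M → ℂ) is a local minimizer of J, then w satisfies the normal equations of the decomposable model, i.e. for every s : Fin K and every m : Fin M, g s w m = 0. -/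
open Finset

/-- The real part of a Hermitian form along a real line is a quadratic polynomial. -/
theorem re_hermitian_form_add_real_smul {ι : Type*} [Fintype ι] (R : Matrix ι ι ℂ)
    (hR : ∀ i j, R i j = (starRingEnd ℂ) (R j i)) (u v : ι → ℂ) (t : ℝ) :
    (∑ i, ∑ j, (starRingEnd ℂ) (u i + t * v i) * R i j * (u j + t * v j)).re =
      (∑ i, ∑ j, (starRingEnd ℂ) (u i) * R i j * u j).re +
        2 * t * (∑ i, ∑ j, (starRingEnd ℂ) (u i) * R i j * v j).re +
        t ^ 2 * (∑ i, ∑ j, (starRingEnd ℂ) (v i) * R i j * v j).re := by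
  have hsymm : (∑ i, ∑ j, (starRingEnd ℂ) (v i) * R i j * u j).re =
      (∑ i, ∑ j, (starRingEnd ℂ) (u i) * R i j * v j).re := by
    rw [← Complex.conj_re, Finset.sum_comm]
    simp only [map_sum, map_mul, Complex.conj_conj, ← hR]
    congr 1
    exact Finset.sum_congr rfl fun i _ => Finset.sum_congr rfl fun j _ => by ring
  have hexp : (∑ i, ∑ j, (starRingEnd ℂ) (u i + t * v i) * R i j * (u j + t * v j)) =
      (∑ i, ∑ j, (starRingEnd ℂ) (u i) * R i j * u j) +
        (t : ℂ) * (∑ i, ∑ j, (starRingEnd ℂ) (u i) * R i j * v j) +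
        (t : ℂ) * (∑ i, ∑ j, (starRingEnd ℂ) (v i) * R i j * u j) +
        ((t ^ 2 : ℝ) : ℂ) * (∑ i, ∑ j, (starRingEnd ℂ) (v i) * R i j * v j) := by
    simp only [Finset.mul_sum, ← Finset.sum_add_distrib]
    refine Finset.sum_congr rfl fun i _ => Finset.sum_congr rfl fun j _ => ?_
    simp only [map_add, map_mul, Complex.conj_ofReal]
    push_cast
    ring
  rw [hexp]
  simp only [Complex.add_re, Complex.re_ofReal_mul, hsymm]
  ring

/-- The linear coefficient of a real quadratic polynomial with a local minimum at `0` vanishes. -/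
theorem linear_coeff_eq_zero_of_isLocalMin {a b c : ℝ}
    (h : IsLocalMin (fun t : ℝ => a + b * t + c * t ^ 2) 0) : b = 0 := by
  refine h.hasDerivAt_eq_zero ?_
  have h1 : HasDerivAt (fun t : ℝ => a + b * t + c * t ^ 2)
      (b * 1 + c * ((2 : ℕ) * (0 : ℝ) ^ (2 - 1) * 1)) 0 :=
    (((hasDerivAt_id (0 : ℝ)).const_mul b).const_add a).add
      (((hasDerivAt_id (0 : ℝ)).pow 2).const_mul c)
  simpa using h1

/-- The decomposable tensor is affine in each coordinate of each factor. -/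
theorem volterraW_update (K M : ℕ) (w : Fin K → Fin M → ℂ) (s : Fin K) (m : Fin M) (z : ℂ)
    (j : Fin K → Fin M) :
    volterraW K M (Function.update w s (w s + Pi.single m z)) j =
      volterraW K M w j + z * (if j s = m then ∏ ℓ ∈ univ.erase s, w ℓ (j ℓ) else 0) := by
  have hprod : ∏ ℓ ∈ univ.erase s,
      Function.update w s (w s + Pi.single m z) ℓ (j ℓ) = ∏ ℓ ∈ univ.erase s, w ℓ (j ℓ) :=
    Finset.prod_congr rfl fun ℓ hℓ => by
      rw [Function.update_of_ne (Finset.ne_of_mem_erase hℓ)]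
  unfold volterraW
  rw [← Finset.mul_prod_erase univ _ (Finset.mem_univ s), hprod,
    ← Finset.mul_prod_erase univ (fun k => w k (j k)) (Finset.mem_univ s)]
  by_cases h : j s = m
  · subst h
    simp [add_mul]
  · simp [h]

/-- The gradient block pairs the residual with the derivative of the decomposable tensor. -/
theorem mul_volterraGrad (K M : ℕ) (R : Matrix (Fin K → Fin M) (Fin K → Fin M) ℂ)
    (r : (Fin K → Fin M) → ℂ) (s : Fin K) (w : Fin K → Fin M → ℂ) (m : Fin M) (c : ℂ) :
    c * volterraGrad K M R r s w m =
      -(∑ j, r j * (c * (if j s = m then ∏ ℓ ∈ univ.erase s, w ℓ (j ℓ) else 0))) +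
      ∑ i, ∑ j, (starRingEnd ℂ) (volterraW K M w i) * R i j *
        (c * (if j s = m then ∏ ℓ ∈ univ.erase s, w ℓ (j ℓ) else 0)) := by
  unfold volterraGrad
  rw [Finset.sum_comm, Finset.sum_filter, Finset.mul_sum, ← Finset.sum_neg_distrib,
    ← Finset.sum_add_distrib]
  refine Finset.sum_congr rfl fun j _ => ?_
  rw [← Finset.sum_mul]
  split_ifs <;> ring

/-- Along a real line in one coordinate, the cost is a quadratic polynomial whose linear
coefficient is given by the gradient block. -/
theorem volterraJ_update (K M : ℕ) (R : Matrix (Fin K → Fin M) (Fin K → Fin M) ℂ)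
    (hR : ∀ i j, R i j = (starRingEnd ℂ) (R j i))
    (r : (Fin K → Fin M) → ℂ) (Rd : ℝ) (w : Fin K → Fin M → ℂ) (s : Fin K) (m : Fin M) (c : ℂ) :
    ∃ q : ℝ, ∀ t : ℝ,
      volterraJ K M R r Rd (Function.update w s (w s + Pi.single m (t * c))) =
        volterraJ K M R r Rd w + 2 * (c * volterraGrad K M R r s w m).re * t + q * t ^ 2 := by
  let v : (Fin K → Fin M) → ℂ :=
    fun j => c * (if j s = m then ∏ ℓ ∈ univ.erase s, w ℓ (j ℓ) else 0)
  refine ⟨(∑ i, ∑ j, (starRingEnd ℂ) (v i) * R i j * v j).re, fun t => ?_⟩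
  have hW : ∀ j, volterraW K M (Function.update w s (w s + Pi.single m (t * c))) j =
      volterraW K M w j + t * v j := fun j => by
    rw [volterraW_update, mul_assoc]
  have hlin : (∑ j, r j * (volterraW K M w j + t * v j)).re =
      (∑ j, r j * volterraW K M w j).re + t * (∑ j, r j * v j).re := by
    rw [← Complex.re_ofReal_mul, ← Complex.add_re, Finset.mul_sum, ← Finset.sum_add_distrib]
    congr 1
    exact Finset.sum_congr rfl fun j _ => by ring
  have hgrad : (c * volterraGrad K M R r s w m).re = -(∑ j, r j * v j).re +
      (∑ i, ∑ j, (starRingEnd ℂ) (volterraW K M w i) * R i j * v j).re := by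
    rw [mul_volterraGrad, Complex.add_re, Complex.neg_re]
  rw [hgrad]
  unfold volterraJ
  simp only [hW]
  rw [hlin, re_hermitian_form_add_real_smul R hR]
  ring

/-- A local minimizer of the MSE cost satisfies the normal equations of the
decomposable model: every gradient block vanishes. -/
theorem localMin_normal_equations (K M : ℕ) (hK : 0 < K) (hM : 0 < M)
    (R : Matrix (Fin K → Fin M) (Fin K → Fin M) ℂ)
    (hR : ∀ i j, R i j = (starRingEnd ℂ) (R j i))
    (r : (Fin K → Fin M) → ℂ) (Rd : ℝ) (w : Fin K → Fin M → ℂ)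
    (hmin : IsLocalMin (volterraJ K M R r Rd) w) :
    ∀ (s : Fin K) (m : Fin M), volterraGrad K M R r s w m = 0 := by
  intro s m
  set g := volterraGrad K M R r s w m with hg
  obtain ⟨q, hq⟩ := volterraJ_update K M R hR r Rd w s m ((starRingEnd ℂ) g)
  let γ : ℝ → Fin K → Fin M → ℂ :=
    fun t => Function.update w s (w s + Pi.single m (t * (starRingEnd ℂ) g))
  have hγ : Continuous γ := by
    refine continuous_const.update s (continuous_const.add ?_)
    exact (continuous_single m).comp (Complex.continuous_ofReal.mul continuous_const)
  have hγ0 : γ 0 = w := by simp [γ]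
  have hloc : IsLocalMin (volterraJ K M R r Rd ∘ γ) 0 :=
    IsLocalMin.comp_continuous (by rwa [hγ0]) hγ.continuousAt
  have hzero := linear_coeff_eq_zero_of_isLocalMin
    ((funext hq : volterraJ K M R r Rd ∘ γ = _) ▸ hloc)
  rw [← hg, ← Complex.normSq_eq_conj_mul_self, Complex.ofReal_re] at hzero
  exact Complex.normSq_eq_zero.mp (by linarith)
end

section
/- Equal initialization keeps all factors equal in the (empirical) gradient recursion: let T : ℕ with 0 < T, data u : Fin T → (Fin M → ℂ) and d : Fin T → ℂ, and μ : ℝ. Let w : ℕ → Fin K → (Fin M → ℂ) satisfy, for all n, s, m, w (n+1) s m = w n s m + μ/T * ∑ t, (d t − ∏ ℓ, (∑ m', u t m' * w n ℓ m')) * conj (∏ ℓ ≠ s, ∑ m', u t m' * w n ℓ m') * conj (u t m). If there is a vector w₀ with w 0 s = w₀ for every s : Fin K, then for every n there is a vector w_n with w n s = w_n for every s; i.e. all K factor filters remain identical at every iteration, so they can never diverge from one another. -/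
open Finset

/-- Equal initialization keeps all `K` factor filters identical at every iteration of the
empirical-gradient recursion for the decomposable (rank-one) Volterra model. -/
theorem equal_init_stays_equal (K M : ℕ) (hK : 0 < K) (hM : 0 < M)
    (T : ℕ) (hT : 0 < T) (u : Fin T → Fin M → ℂ) (d : Fin T → ℂ) (μ : ℝ)
    (w : ℕ → Fin K → Fin M → ℂ)
    (hrec : ∀ (n : ℕ) (s : Fin K) (m : Fin M),
      w (n + 1) s m = w n s m + ((μ / (T : ℝ) : ℝ) : ℂ) *
        ∑ t, (d t - ∏ ℓ, (∑ m', u t m' * w n ℓ m')) *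
          (starRingEnd ℂ) (∏ ℓ ∈ univ.erase s, ∑ m', u t m' * w n ℓ m') *
          (starRingEnd ℂ) (u t m))
    (h0 : ∃ w₀ : Fin M → ℂ, ∀ s, w 0 s = w₀) :
    ∀ n : ℕ, ∃ wn : Fin M → ℂ, ∀ s, w n s = wn := by
  intro n
  induction n with
  | zero => exact h0
  | succ n ih =>
    obtain ⟨v, hv⟩ := ih
    refine ⟨w (n + 1) ⟨0, hK⟩, fun s => ?_⟩
    ext m
    simp only [hrec, hv, prod_const, card_erase_of_mem (mem_univ _)]
end

section
/- Compact form of the rectangular-window gradient estimate: fix L : ℕ with 0 < L, window data u : Fin L → (Fin M → ℂ) and d : Fin L → ℂ, and a family w : Fin K → (Fin M → ℂ). Define the empirical correlations ŕ i = (1/L) * ∑ j, (∏ k, u j (i k)) * conj (d j) (for i : Fin K → Fin M) and Ŕ i i' = (1/L) * ∑ j, conj (∏ k, u j (i k)) * (∏ k, u j (i' k)). Then for every s : Fin K and every m : Fin M, ∑ over multi-indices i with i s = m of (−(ŕ i) + ∑ i', conj ((∏ k, w k (i' k))) * Ŕ i' i) * ∏ ℓ ≠ s, w ℓ (i ℓ)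 = −(1/L) * ∑ j, conj (d j − ∏ ℓ, (∑ m', u j m' * w ℓ m')) * (∏ ℓ ≠ s, ∑ m', u j m' * w ℓ m') * u j m. That is, the block estimated gradient [−R̃_{u^K d} + 𝒲* R̃_{u^K}] 𝒲^{(s)} equals −(1/L) ∑_j e(j)* y_s(j) u_j. -/
open Finset

/-- A sum of products over the functions with a prescribed value at `s` factors into the
value at `s` and one sum for each other index. -/
theorem sum_filter_apply_eq_prod_mul_prod_erase {ι κ R : Type*} [Fintype ι] [DecidableEq ι]
    [Fintype κ] [DecidableEq κ] [CommSemiring R] (v : κ → R) (w : ι → κ → R) (s : ι) (m : κ) :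
    ∑ i ∈ univ.filter (fun i : ι → κ => i s = m),
        (∏ k, v (i k)) * ∏ l ∈ univ.erase s, w l (i l) =
      v m * ∏ l ∈ univ.erase s, ∑ m', v m' * w l m' := by
  have hfilter : univ.filter (fun i : ι → κ => i s = m) =
      Fintype.piFinset (Function.update (fun _ => univ) s ({m} : Finset κ)) := by
    ext i
    simp only [mem_filter, mem_univ, true_and, Fintype.mem_piFinset]
    refine ⟨fun h k => ?_, fun h => by simpa using h s⟩
    rcases eq_or_ne k s with rfl | hk <;> simp [*]
  have hterm (i : ι → κ) : (∏ k, v (i k)) * ∏ l ∈ univ.erase s, w l (i l) =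
      ∏ k, v (i k) * (if k = s then 1 else w k (i k)) := by
    rw [prod_mul_distrib, ← mul_prod_erase univ (fun k => if k = s then 1 else w k (i k))
      (mem_univ s), if_pos rfl, one_mul]
    congr 1
    exact prod_congr rfl fun k hk => (if_neg (ne_of_mem_erase hk)).symm
  rw [sum_congr rfl fun i _ => hterm i, hfilter,
    ← prod_univ_sum _ (fun k x => v x * (if k = s then 1 else w k x)),
    ← mul_prod_erase univ _ (mem_univ s)]
  congr 1
  · simp
  · refine prod_congr rfl fun k hk => ?_
    simp [ne_of_mem_erase hk]

/-- Contracting two decomposable tensors gives the product of the factorwise dot products. -/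
theorem sum_prod_mul_prod_eq_prod_sum {ι κ R : Type*} [Fintype ι] [DecidableEq ι]
    [Fintype κ] [CommSemiring R] (v : κ → R) (w : ι → κ → R) :
    ∑ i : ι → κ, (∏ k, w k (i k)) * ∏ k, v (i k) = ∏ k, ∑ m, v m * w k m := by
  simp_rw [Fintype.prod_sum, prod_mul_distrib, mul_comm]

/-- Compact form of the rectangular-window gradient estimate: the block estimated
gradient `[−R̃_{u^K d} + 𝒲* R̃_{u^K}] 𝒲^{(s)}` equals `−(1/L) ∑_j e(j)* y_s(j) u_j`. -/
theorem rectangular_window_gradient (K M L : ℕ) (hK : 0 < K) (hM : 0 < M) (hL : 0 < L)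
    (u : Fin L → Fin M → ℂ) (d : Fin L → ℂ) (w : Fin K → Fin M → ℂ)
    (rhat : (Fin K → Fin M) → ℂ)
    (hrhat : ∀ i, rhat i = (1 / (L : ℂ)) * ∑ j, (∏ k, u j (i k)) * (starRingEnd ℂ) (d j))
    (Rhat : Matrix (Fin K → Fin M) (Fin K → Fin M) ℂ)
    (hRhat : ∀ i i', Rhat i i' =
      (1 / (L : ℂ)) * ∑ j, (starRingEnd ℂ) (∏ k, u j (i k)) * (∏ k, u j (i' k)))
    (s : Fin K) (m : Fin M) :
    ∑ i ∈ univ.filter (fun i : Fin K → Fin M => i s = m),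
        (-(rhat i) + ∑ i', (starRingEnd ℂ) (∏ k, w k (i' k)) * Rhat i' i) *
          ∏ ℓ ∈ univ.erase s, w ℓ (i ℓ) =
      -(1 / (L : ℂ)) * ∑ j,
        (starRingEnd ℂ) (d j - ∏ ℓ, (∑ m', u j m' * w ℓ m')) *
          (∏ ℓ ∈ univ.erase s, ∑ m', u j m' * w ℓ m') * u j m := by
  have hgrad (i : Fin K → Fin M) :
      -(rhat i) + ∑ i', (starRingEnd ℂ) (∏ k, w k (i' k)) * Rhat i' i =
        -(1 / (L : ℂ)) * ∑ j, (starRingEnd ℂ) (d j - ∏ ℓ, (∑ m', u j m' * w ℓ m')) *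
          ∏ k, u j (i k) := by
    have hR : ∑ i', (starRingEnd ℂ) (∏ k, w k (i' k)) * Rhat i' i =
        (1 / (L : ℂ)) * ∑ j, (starRingEnd ℂ) (∏ ℓ, (∑ m', u j m' * w ℓ m')) *
          ∏ k, u j (i k) := by
      simp_rw [hRhat, ← sum_prod_mul_prod_eq_prod_sum, map_sum, map_mul, mul_sum, sum_mul,
        mul_sum]
      rw [sum_comm]
      exact sum_congr rfl fun j _ => sum_congr rfl fun i' _ => by ring
    simp_rw [hR, hrhat, map_sub, sub_mul, sum_sub_distrib, mul_comm (∏ k, u _ (i k))]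
    ring
  simp_rw [hgrad, mul_assoc, ← mul_sum, sum_mul]
  congr 1
  rw [sum_comm]
  refine sum_congr rfl fun j _ => ?_
  simp_rw [mul_assoc, ← mul_sum]
  rw [sum_filter_apply_eq_prod_mul_prod_erase, mul_comm (u j m)]
end
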